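/- Let A be a unital C*-algebra and let ψ be a state on A (a linear functional with ψ(1) = 1 and ψ(x*x) real and nonnegative for all x). Then there exists a family (ν_C)_{C ∈ 𝒞(A)}, where each ν_C is a regular Borel probability measure on the Gelfand spectrum Σ_C, such that: (a) for every C ∈ 𝒞(A) and every c ∈ C, ∫_{Σ_C} λ(c) dν_C(λ) = ψ(c); and (b) for all D ⊆ C in 𝒞(A), ν_D equals the pushforward of ν_C along the restriction map ρ_{CD}. Consequently, for every Σ↓-open subset U ⊆ Σ_e, the function C ↦ ν_C(U_C) is order-reversing on 𝒞(A). -/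

import Mathlib

open scoped ComplexOrder

noncomputable section

/-- A character of a commutative unital *-subalgebra: a unital *-algebra homomorphism
to `ℂ`. -/
abbrev Character {E : Type*} [Ring E] [StarRing E] [Algebra ℂ E] [StarModule ℂ E]
    (C : StarSubalgebra ℂ E) : Type _ := C →⋆ₐ[ℂ] ℂ

/-- The topology of pointwise convergence on characters (the Gelfand topology). -/
instance {E : Type*} [Ring E] [StarRing E] [Algebra ℂ E] [StarModule ℂ E]
    (C : StarSubalgebra ℂ E) : TopologicalSpace (Character C) :=
  TopologicalSpace.induced (fun φ => (φ : C → ℂ)) inferInstance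

/-- The restriction map `ρ_{CD}` on characters along an inclusion of subalgebras. -/
def resChar {E : Type*} [Ring E] [StarRing E] [Algebra ℂ E] [StarModule ℂ E]
    {C D : StarSubalgebra ℂ E} (h : D ≤ C) (φ : Character C) : Character D :=
  φ.comp (StarSubalgebra.inclusion h)

variable (A : Type*) [NormedRing A] [StarRing A] [CStarRing A] [NormedAlgebra ℂ A]
  [StarModule ℂ A] [CompleteSpace A]

/-- A context of the unital C*-algebra `A`: a commutative unital closed *-subalgebra. -/
structure Ctx where
  alg : StarSubalgebra ℂ A
  closed : IsClosed (alg : Set A)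
  comm : ∀ x ∈ alg, ∀ y ∈ alg, x * y = y * x

/-- The disjoint union `Σ_e = ⨿_{C ∈ 𝒞(A)} Σ_C`. -/
abbrev SigmaE := Σ C : Ctx A, Character C.alg

variable {A}

/-- Condition (ii): closedness of `U` under restriction of characters (étale openness). -/
def EtaleOpen (U : Set (SigmaE A)) : Prop :=
  ∀ C D : Ctx A, ∀ h : D.alg ≤ C.alg, ∀ φ : Character C.alg,
    (⟨C, φ⟩ : SigmaE A) ∈ U → (⟨D, resChar h φ⟩ : SigmaE A) ∈ U

/-- A subset `U ⊆ Σ_e` is Σ↓-open if every `U_C` is open in `Σ_C` and `U` is closed under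
restriction of characters. -/
def IsSigmaDownOpen (U : Set (SigmaE A)) : Prop :=
  (∀ C : Ctx A, IsOpen {φ : Character C.alg | (⟨C, φ⟩ : SigmaE A) ∈ U}) ∧ EtaleOpen U

open MeasureTheory

/-- Borel σ-algebra on each Gelfand spectrum. -/
instance {E : Type*} [Ring E] [StarRing E] [Algebra ℂ E] [StarModule ℂ E]
    (C : StarSubalgebra ℂ E) : MeasurableSpace (Character C) := borel _

section RieszMarkovKakutani

variable {X : Type*} [TopologicalSpace X]

/-- A real-valued continuous function, viewed as a complex-valued one. -/
def complexify (f : C(X, ℝ)) : C(X, ℂ) := ⟨fun x => (f x : ℂ), by fun_prop⟩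

theorem complexify_eq_star_mul_self {f : C(X, ℝ)} (hf : 0 ≤ f) :
    ∃ g : C(X, ℂ), complexify f = star g * g := by
  refine ⟨complexify ⟨fun x => √(f x), by fun_prop⟩, ?_⟩
  ext x
  simpa [complexify, ← Complex.ofReal_mul] using (Real.mul_self_sqrt (hf x)).symm

theorem map_complexify_im_eq_zero (Λ : C(X, ℂ) →ₗ[ℂ] ℂ) (hΛ : ∀ g, 0 ≤ Λ (star g * g))
    (f : C(X, ℝ)) : (Λ (complexify f)).im = 0 := by
  have key : ∀ f : C(X, ℝ), 0 ≤ f → (Λ (complexify f)).im = 0 := by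
    intro f hf
    obtain ⟨g, hg⟩ := complexify_eq_star_mul_self hf
    rw [hg]
    exact (Complex.nonneg_iff.mp (hΛ g)).2.symm
  have hdecomp : complexify f = complexify (f ⊔ 0) - complexify (-f ⊔ 0) := by
    ext x
    simp only [complexify, ContinuousMap.coe_mk, ContinuousMap.sub_apply,
      ContinuousMap.sup_apply, ContinuousMap.zero_apply, ContinuousMap.neg_apply,
      ← Complex.ofReal_sub]
    congr 1
    rcases le_total (f x) 0 with h | h <;> simp [h]
  rw [hdecomp, map_sub, Complex.sub_im, key _ le_sup_right, key _ le_sup_right, sub_zero]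

variable [CompactSpace X] [T2Space X] [MeasurableSpace X] [BorelSpace X]

/-- The Riesz–Markov–Kakutani theorem for positive complex-linear functionals on `C(X, ℂ)`. -/
theorem exists_regular_integral_eq (Λ : C(X, ℂ) →ₗ[ℂ] ℂ) (hΛ : ∀ g, 0 ≤ Λ (star g * g)) :
    ∃ μ : Measure X, IsFiniteMeasure μ ∧ μ.Regular ∧ ∀ f : C(X, ℂ), ∫ x, f x ∂μ = Λ f := by
  let Λ₀ : CompactlySupportedContinuousMap X ℝ →ₗ[ℝ] ℝ :=
    { toFun := fun f => (Λ (complexify f.toContinuousMap)).re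
      map_add' := fun f g => by
        rw [← Complex.add_re, ← map_add]
        congr 2
        ext x
        simp [complexify]
      map_smul' := fun r f => by
        rw [RingHom.id_apply, smul_eq_mul, ← Complex.re_ofReal_mul, ← smul_eq_mul, ← map_smul]
        congr 2
        ext x
        simp [complexify] }
  let Λr : CompactlySupportedContinuousMap X ℝ →ₚ[ℝ] ℝ := PositiveLinearMap.mk₀ Λ₀ (by
    intro f hf
    obtain ⟨g, hg⟩ := complexify_eq_star_mul_self (f := f.toContinuousMap) hf
    change 0 ≤ (Λ (complexify f.toContinuousMap)).re
    rw [hg]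
    exact (Complex.nonneg_iff.mp (hΛ g)).1)
  have hreal (f : C(X, ℝ)) : ((∫ x, f x ∂(RealRMK.rieszMeasure Λr) : ℝ) : ℂ) =
      Λ (complexify f) := by
    have h := RealRMK.integral_rieszMeasure Λr
      (CompactlySupportedContinuousMap.continuousMapEquiv f)
    refine Complex.ext ?_ ?_
    · exact h
    · rw [Complex.ofReal_im, map_complexify_im_eq_zero Λ hΛ]
  refine ⟨RealRMK.rieszMeasure Λr, inferInstance, inferInstance, fun f => ?_⟩
  have hint : Integrable f (RealRMK.rieszMeasure Λr) :=
    f.continuous.integrable_of_hasCompactSupport (HasCompactSupport.of_compactSpace f)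
  let fre : C(X, ℝ) := ⟨fun x => (f x).re, by fun_prop⟩
  let fim : C(X, ℝ) := ⟨fun x => (f x).im, by fun_prop⟩
  have hf : f = complexify fre + Complex.I • complexify fim := by
    ext x
    simp [complexify, fre, fim, mul_comm Complex.I, Complex.re_add_im]
  have h := integral_re_add_im hint
  rw [← h]
  conv_rhs => rw [hf, map_add, map_smul, ← hreal, ← hreal, smul_eq_mul, mul_comm]
  rfl

/-- Finite regular measures on a compact Hausdorff space are determined by the integrals of
continuous complex-valued functions. -/
theorem ext_of_integral_continuousMap_eq {μ ν : Measure X} [μ.Regular] [ν.Regular]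
    (h : ∀ f : C(X, ℂ), ∫ x, f x ∂μ = ∫ x, f x ∂ν) : μ = ν := by
  refine Measure.ext_of_integral_eq_on_compactlySupported fun f => ?_
  have hf := h (complexify f.toContinuousMap)
  change ∫ x, ((f x : ℝ) : ℂ) ∂μ = ∫ x, ((f x : ℝ) : ℂ) ∂ν at hf
  rwa [integral_complex_ofReal, integral_complex_ofReal, Complex.ofReal_inj] at hf

end RieszMarkovKakutani

instance {E : Type*} [Ring E] [StarRing E] [Algebra ℂ E] [StarModule ℂ E]
    (C : StarSubalgebra ℂ E) : BorelSpace (Character C) := ⟨rfl⟩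

theorem continuous_character_apply {E : Type*} [Ring E] [StarRing E] [Algebra ℂ E]
    [StarModule ℂ E] {C : StarSubalgebra ℂ E} (c : C) :
    Continuous fun φ : Character C => φ c :=
  (continuous_apply c).comp continuous_induced_dom

theorem continuous_resChar {E : Type*} [Ring E] [StarRing E] [Algebra ℂ E] [StarModule ℂ E]
    {C D : StarSubalgebra ℂ E} (h : D ≤ C) : Continuous (resChar h) :=
  continuous_induced_rng.mpr <| continuous_pi fun d =>
    continuous_character_apply (StarSubalgebra.inclusion h d)

namespace Ctx

/-- A context is a commutative C*-algebra. -/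
abbrev commCStarAlgebra (C : Ctx A) : CommCStarAlgebra C.alg where
  toCompleteSpace := C.closed.completeSpace_coe
  norm_mul_self_le x := CStarRing.norm_star_mul_self (x := (x : A)) |>.symm.le
  mul_comm x y := Subtype.ext (C.comm x x.2 y y.2)

/-- Mathlib's character space of a context is homeomorphic to its space of *-characters. -/
def characterHomeo (C : Ctx A) :
    letI := C.commCStarAlgebra
    WeakDual.characterSpace ℂ C.alg ≃ₜ Character C.alg :=
  letI := C.commCStarAlgebra
  { toFun := fun φ =>
      { WeakDual.CharacterSpace.toAlgHom φ with map_star' := fun a => map_star φ a }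
    invFun := fun φ => WeakDual.CharacterSpace.equivAlgHom.symm φ.toAlgHom
    left_inv := fun _ => rfl
    right_inv := fun _ => rfl
    continuous_toFun := continuous_induced_rng.mpr <| continuous_pi fun c =>
      (WeakDual.eval_continuous c).comp continuous_subtype_val
    continuous_invFun := Continuous.subtype_mk
      (WeakDual.continuous_of_continuous_eval fun c => continuous_character_apply c) _ }

instance (C : Ctx A) : CompactSpace (Character C.alg) :=
  letI := C.commCStarAlgebra
  C.characterHomeo.compactSpace

instance (C : Ctx A) : T2Space (Character C.alg) :=
  letI := C.commCStarAlgebra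
  C.characterHomeo.t2Space

/-- The Gelfand isomorphism of a context with the continuous functions on its characters. -/
def gelfand (C : Ctx A) : C.alg ≃⋆ₐ[ℂ] C(Character C.alg, ℂ) :=
  letI := C.commCStarAlgebra
  (gelfandStarTransform C.alg).trans (C.characterHomeo.symm.compStarAlgEquiv' ℂ ℂ)

theorem gelfand_apply (C : Ctx A) (c : C.alg) (φ : Character C.alg) : C.gelfand c φ = φ c :=
  rfl

/-- A positive functional on `A` is represented on each context by a finite regular measure. -/
theorem exists_regular_integral_eq (C : Ctx A) (ψ : A →ₗ[ℂ] ℂ)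
    (hψ : ∀ x : A, 0 ≤ ψ (star x * x)) :
    ∃ μ : Measure (Character C.alg), IsFiniteMeasure μ ∧ μ.Regular ∧
      ∀ c : C.alg, ∫ φ, φ c ∂μ = ψ c := by
  let Λ : C(Character C.alg, ℂ) →ₗ[ℂ] ℂ :=
    { toFun := fun f => ψ (C.gelfand.symm f)
      map_add' := fun f g => by simp
      map_smul' := fun r f => by simp }
  obtain ⟨μ, hfin, hreg, hμ⟩ := _root_.exists_regular_integral_eq Λ fun g => by
    simpa [Λ, map_star C.gelfand.symm g] using hψ (C.gelfand.symm g)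
  refine ⟨μ, hfin, hreg, fun c => ?_⟩
  simpa [Λ, gelfand_apply] using hμ (C.gelfand c)

theorem ext_of_integral_eq (C : Ctx A) {μ ν : Measure (Character C.alg)} [μ.Regular]
    [ν.Regular] (h : ∀ c : C.alg, ∫ φ, φ c ∂μ = ∫ φ, φ c ∂ν) : μ = ν := by
  refine ext_of_integral_continuousMap_eq fun f => ?_
  obtain ⟨c, rfl⟩ := C.gelfand.surjective f
  exact h c

end Ctx

/-- Every state `ψ` on a unital C*-algebra `A` gives rise to a family of
regular Borel probability measures `ν_C` on the Gelfand spectra `Σ_C` with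
(a) `∫ λ(c) dν_C = ψ(c)` for `c ∈ C`, and (b) `ν_D = (ρ_{CD})_* ν_C` for `D ⊆ C`;
consequently `C ↦ ν_C(U_C)` is order-reversing for every Σ↓-open `U`. -/
theorem state_gives_compatible_measures
    (ψ : A →ₗ[ℂ] ℂ) (hψ1 : ψ 1 = 1) (hψpos : ∀ x : A, 0 ≤ ψ (star x * x)) :
    ∃ ν : (C : Ctx A) → Measure (Character C.alg),
      (∀ C : Ctx A, IsProbabilityMeasure (ν C) ∧ (ν C).Regular) ∧
      (∀ C : Ctx A, ∀ c : A, ∀ hc : c ∈ C.alg,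
        ∫ φ : Character C.alg, φ ⟨c, hc⟩ ∂(ν C) = ψ c) ∧
      (∀ C D : Ctx A, ∀ h : D.alg ≤ C.alg, ν D = (ν C).map (resChar h)) ∧
      (∀ U : Set (SigmaE A), IsSigmaDownOpen U →
        ∀ C D : Ctx A, D.alg ≤ C.alg →
          ν C {φ : Character C.alg | (⟨C, φ⟩ : SigmaE A) ∈ U} ≤
            ν D {φ : Character D.alg | (⟨D, φ⟩ : SigmaE A) ∈ U}) := by
  choose ν hfin hreg hν using fun C : Ctx A => C.exists_regular_integral_eq ψ hψpos
  have hmap : ∀ C D : Ctx A, ∀ h : D.alg ≤ C.alg, ν D = (ν C).map (resChar h) := by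
    intro C D h
    have := ((inferInstance : (ν C).InnerRegularCompactLTTop).map_of_continuous
      (continuous_resChar h))
    refine D.ext_of_integral_eq fun d => ?_
    rw [integral_map (continuous_resChar h).aemeasurable
      (continuous_character_apply d).aestronglyMeasurable, hν]
    exact (hν C (StarSubalgebra.inclusion h d)).symm
  refine ⟨ν, fun C => ⟨?_, hreg C⟩, fun C c hc => hν C ⟨c, hc⟩, hmap, ?_⟩
  · have h1 := hν C 1
    simp only [map_one, integral_const, OneMemClass.coe_one, hψ1] at h1
    rw [isProbabilityMeasure_iff_real]
    simpa using h1
  · intro U hU C D h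
    rw [hmap C D h, Measure.map_apply (continuous_resChar h).measurable (hU.1 D).measurableSet]
    exact measure_mono fun φ hφ => hU.2 C D h φ hφ

end
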